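/- Let k = (p−1)/2 and 1 ≤ j ≤ 2k−1. Then ε_A := (−1)^{k+j+1}·[w_{j+1}, ..., w_{2k}, ω_k] equals (−1)^k; moreover, for V = [p, k, j, ε_A], the quadratic polynomial P(X) = X² + 2·(−1)^j·T·X + 1 divides H(V) in F_p[T][X], and the root α ∈ F(p) of H(V) defined by α = [w_{j+1}T, ..., w_{2k}T, α_{2k−j+1}] and α^p = ε_A·(−1)^{k+j}·(P_k·α_{2k−j+1} − R_k) satisfies α = (−1)^j·ρ and P(α) = 0, where ρ = [−2T, 2T, −2T, 2T, ...]. -/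

import Mathlib

open Polynomial

noncomputable section

/-- The continuant of a finite word: `⟨∅⟩ = 1`, `⟨u₁⟩ = u₁`, and
`⟨u₁,…,uₘ⟩ = uₘ·⟨u₁,…,u_{m-1}⟩ + ⟨u₁,…,u_{m-2}⟩`. -/
def cont {R : Type*} [CommRing R] (l : List R) : R :=
  (l.foldl (fun q a => (a * q.1 + q.2, q.1)) ((1 : R), (0 : R))).1

/-- Finite continued fraction `[a₁,…,aₙ] = a₁ + 1/(a₂ + 1/(…))`. -/
def cfrac {K : Type*} [DivisionRing K] : List K → K
  | [] => 0
  | [a] => a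
  | a :: b :: l => a + (cfrac (b :: l))⁻¹

/-- `1/T`, viewed in the field `F(p) = F_p((1/T))` of Laurent series in `1/T`. -/
def Tinv (K : Type*) [Field K] : LaurentSeries K := HahnSeries.single (-1 : ℤ) 1

/-- `P_k(T) = (T² - 1)^k` in `F_p[T]`. -/
def Pk (p k : ℕ) : Polynomial (ZMod p) := ((X : Polynomial (ZMod p)) ^ 2 - 1) ^ k

/-- `R_k`, the remainder in the Euclidean division of `T^p` by `P_k`. -/
def Rk (p k : ℕ) : Polynomial (ZMod p) := (X : Polynomial (ZMod p)) ^ p %ₘ Pk p k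

theorem aux_omega (p k : ℕ) [Fact (Nat.Prime p)] (hpk : p = 2 * k + 1) :
    ∏ i ∈ Finset.Icc 1 k, (1 - (2 * (i : ZMod p))⁻¹) = (-1) ^ k := by
  have h0 : (2 * (k : ZMod p) + 1) = 0 := by
    have := ZMod.natCast_self p
    have h : ((2 * k + 1 : ℕ) : ZMod p) = 0 := by rw [← hpk]; exact this
    push_cast at h
    exact h
  have hne : ∀ i : ℕ, 1 ≤ i → i < p → (i : ZMod p) ≠ 0 := by
    intro i h1 h2 h
    rw [ZMod.natCast_eq_zero_iff] at h
    exact absurd (Nat.le_of_dvd h1 h) (by omega)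
  have h2 : (2 : ZMod p) ≠ 0 := by
    intro h
    rw [h] at h0
    simp at h0
  have hterm : ∀ i ∈ Finset.Icc 1 k, (1 - (2 * (i : ZMod p))⁻¹)
      = (-1) * ((k + 1 - i : ℕ) : ZMod p) / (i : ZMod p) := by
    intro i hi
    rw [Finset.mem_Icc] at hi
    have n1 := hne i hi.1 (by omega)
    rw [Nat.cast_sub (by omega)]
    push_cast
    field_simp
    linear_combination h0
  rw [Finset.prod_congr rfl hterm, Finset.prod_div_distrib, Finset.prod_mul_distrib]
  have hrefl : ∏ i ∈ Finset.Icc 1 k, ((k + 1 - i : ℕ) : ZMod p)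
      = ∏ i ∈ Finset.Icc 1 k, (i : ZMod p) := by
    apply Finset.prod_nbij' (fun i => k + 1 - i) (fun i => k + 1 - i)
    · intro i hi; rw [Finset.mem_Icc] at *; omega
    · intro i hi; rw [Finset.mem_Icc] at *; omega
    · intro i hi; rw [Finset.mem_Icc] at *; omega
    · intro i hi; rw [Finset.mem_Icc] at *; omega
    · intro i hi; rfl
  rw [hrefl, mul_div_assoc, div_self, mul_one, Finset.prod_const, Nat.card_Icc]
  · simp
  · rw [Finset.prod_ne_zero_iff]
    intro i hi
    rw [Finset.mem_Icc] at hi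
    exact hne i hi.1 (by omega)

theorem aux_w (p k : ℕ) [Fact (Nat.Prime p)] (hk1 : 1 ≤ k) (hpk : p = 2 * k + 1)
    (ω : ZMod p) (hω : ω = -1) (w : ℕ → ZMod p)
    (hw1 : w 1 = (2 * (k : ZMod p) - 1) * (2 * (k : ZMod p) * ω)⁻¹)
    (hwrec : ∀ i, 1 ≤ i → i ≤ 2 * k - 1 →
      w (i + 1) * w i =
        (2 * (k : ZMod p) - 2 * (i : ZMod p) - 1) * (2 * (k : ZMod p) - 2 * (i : ZMod p) + 1)
          * ((i : ZMod p) * (2 * (k : ZMod p) - (i : ZMod p)))⁻¹) :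
    ∀ i, 1 ≤ i → i ≤ 2 * k → w i = 2 * (-1) ^ i := by
  have h0 : 2 * (k : ZMod p) = -1 := by
    have := ZMod.natCast_self p
    have h : ((2 * k + 1 : ℕ) : ZMod p) = 0 := by rw [← hpk]; exact this
    push_cast at h
    linear_combination h
  have hne : ∀ i : ℕ, 1 ≤ i → i < p → (i : ZMod p) ≠ 0 := by
    intro i h1 h2 h
    rw [ZMod.natCast_eq_zero_iff] at h
    exact absurd (Nat.le_of_dvd h1 h) (by omega)
  have h2 : (2 : ZMod p) ≠ 0 := by exact_mod_cast hne 2 (by omega) (by omega)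
  intro i hi
  induction i, hi using Nat.le_induction with
  | base =>
    intro _
    rw [hw1, h0, hω]; norm_num
  | succ i hi ih =>
    intro hi2
    have h := hwrec i hi (by omega)
    rw [ih (by omega), h0] at h
    have n1 := hne i hi (by omega)
    have n2 := hne (i+1) (by omega) (by omega)
    push_cast at n2
    have n3 : (-1 - (i : ZMod p)) ≠ 0 := by
      intro h; apply n2; linear_combination -h
    have h3 : (-1 - 2 * (i : ZMod p) - 1) * (-1 - 2 * (i : ZMod p) + 1)
        * ((i : ZMod p) * (-1 - (i : ZMod p)))⁻¹ = -4 := by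
      rw [← div_eq_mul_inv, div_eq_iff (mul_ne_zero n1 n3)]; ring
    rw [h3] at h
    have s : ((-1 : ZMod p) ^ i) * (-1) ^ i = 1 := by
      rw [← mul_pow]; simp
    apply mul_left_cancel₀ h2
    rw [pow_succ]
    linear_combination (-1 : ZMod p) ^ i * h - 2 * w (i+1) * s

theorem aux_cfrac_cons {F : Type*} [Field F] (a : F) (l : List F) (h : l ≠ []) :
    cfrac (a :: l) = a + (cfrac l)⁻¹ := by
  cases l with
  | nil => exact absurd rfl h
  | cons b l => rfl

theorem aux_cfrac {F : Type*} [Field F] (w : ℕ → F) (n : ℕ) : ∀ j : ℕ,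
    (∀ i, j + 1 ≤ i → i ≤ j + n → w i = 2 * (-1) ^ i) →
    cfrac (((List.range n).map fun i => w (j + 1 + i)) ++ [(-1) ^ (j + n + 1)])
      = (-1) ^ (j + 1) := by
  induction n with
  | zero => intro j _; simp [cfrac]
  | succ n ih =>
    intro j h
    rw [List.range_succ_eq_map, List.map_cons, List.cons_append, aux_cfrac_cons _ _ (by simp),
      List.map_map]
    have h1 := ih (j + 1) (fun i h1 h2 => h i (by omega) (by omega))
    have e : ((fun i => w (j + 1 + i)) ∘ Nat.succ) = fun i => w (j + 1 + 1 + i) := by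
      funext i; simp only [Function.comp, Nat.succ_eq_add_one]; congr 1; omega
    rw [e, show j + (n + 1) + 1 = j + 1 + n + 1 by omega, h1, Nat.add_zero,
      h (j + 1) (by omega) (by omega)]
    rw [← inv_pow, inv_neg_one]; ring

theorem aux_R (p k : ℕ) [Fact (Nat.Prime p)] (hk1 : 1 ≤ k) (hpk : p = 2 * k + 1) :
    Rk p k = X ^ p - X * Pk p k := by
  have hm : (Pk p k).Monic := by
    unfold Pk
    exact (monic_X_pow_sub_C (1 : ZMod p) two_ne_zero).pow k
  have hdeg : (Pk p k).natDegree = 2 * k := by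
    have h := natDegree_X_pow_sub_C (n := 2) (r := (1 : ZMod p))
    rw [C_1] at h
    unfold Pk
    rw [natDegree_pow, h]; ring
  have h1 : ((X : (ZMod p)[X]) ^ k - (X - 1) ^ k).natDegree < k := by
    have hm1 : ((X : (ZMod p)[X]) - 1).Monic := monic_X_sub_C (1 : ZMod p)
    have hd1 : ((X : (ZMod p)[X]) - 1).natDegree = 1 := natDegree_X_sub_C (1 : ZMod p)
    have hd2 : (((X : (ZMod p)[X]) - 1) ^ k).natDegree = k := by
      rw [natDegree_pow, hd1, mul_one]
    have hlt : ((X : (ZMod p)[X]) ^ k - (X - 1) ^ k).degree < ((X : (ZMod p)[X]) ^ k).degree := by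
      apply degree_sub_lt_left
      · rw [degree_X_pow, degree_eq_natDegree (hm1.pow k).ne_zero, hd2]
      · exact (monic_X_pow k).ne_zero
      · rw [(monic_X_pow k).leadingCoeff, (hm1.pow k).leadingCoeff]
    rw [degree_X_pow] at hlt
    by_cases hz : ((X : (ZMod p)[X]) ^ k - (X - 1) ^ k) = 0
    · rw [hz, natDegree_zero]; exact hk1
    · exact (natDegree_lt_iff_degree_lt hz).2 hlt
  have e : (X : (ZMod p)[X]) ^ p - X * Pk p k
      = X * ((X : (ZMod p)[X]) ^ k - (X - 1) ^ k).comp (X ^ 2) := by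
    simp only [sub_comp, pow_comp, X_comp, one_comp]
    unfold Pk
    have hp' : (X : (ZMod p)[X]) ^ p = X ^ (2 * k + 1) := congrArg _ hpk
    rw [hp']
    ring
  have hlt : ((X : (ZMod p)[X]) ^ p - X * Pk p k).degree < (Pk p k).degree := by
    rw [degree_eq_natDegree hm.ne_zero, hdeg]
    refine lt_of_le_of_lt degree_le_natDegree ?_
    rw [e]
    have a1 := natDegree_mul_le (p := (X : (ZMod p)[X]))
      (q := ((X : (ZMod p)[X]) ^ k - (X - 1) ^ k).comp (X ^ 2))
    rw [natDegree_comp, natDegree_X_pow, natDegree_X] at a1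
    exact_mod_cast (show _ < 2 * k by omega)
  exact (div_modByMonic_unique (X) _ hm ⟨by ring, hlt⟩).2

theorem aux_cont {R : Type*} [CommRing R] (f : ℕ → R) (n : ℕ) :
    cont ((List.range (n + 2)).map f)
      = f (n + 1) * cont ((List.range (n + 1)).map f) + cont ((List.range n).map f) := by
  simp [cont, List.range_succ, List.foldl_append]

theorem aux_step {F : Type*} [Field F] (x y c x' y' : LaurentSeries F)
    (hx : x = c + x'⁻¹) (hy : y = c + y'⁻¹) (ox : x'.order < 0) (oy : y'.order < 0)
    (hne : x - y ≠ 0) :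
    0 < (x - y).order ∧ x' - y' ≠ 0 ∧ (x' - y').order + 2 ≤ (x - y).order := by
  have x0 : x' ≠ 0 := by rintro rfl; simp at ox
  have y0 : y' ≠ 0 := by rintro rfl; simp at oy
  have e : x' - y' = - ((x - y) * (x' * y')) := by
    rw [hx, hy]; field_simp; ring
  have n' : x' - y' ≠ 0 := by
    rw [e]; exact neg_ne_zero.2 (mul_ne_zero hne (mul_ne_zero x0 y0))
  have oo : (x' - y').order = (x - y).order + (x'.order + y'.order) := by
    rw [e, HahnSeries.order_neg, HahnSeries.order_mul hne (mul_ne_zero x0 y0),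
      HahnSeries.order_mul x0 y0]
  have m : min x'.order y'.order ≤ (x' - y').order := by
    rw [sub_eq_add_neg] at n' ⊢
    have := HahnSeries.min_order_le_order_add n'
    rwa [HahnSeries.order_neg] at this
  refine ⟨?_, n', by omega⟩
  rcases min_choice x'.order y'.order with h | h <;> omega

theorem aux_iter {F : Type*} [Field F] (a b c : ℕ → LaurentSeries F) (N : ℕ)
    (ha : ∀ i, 1 ≤ i → i ≤ N → a i = c i + (a (i+1))⁻¹)
    (hb : ∀ i, 1 ≤ i → i ≤ N → b i = c i + (b (i+1))⁻¹)
    (oa : ∀ i, 1 ≤ i → (a i).order < 0) (ob : ∀ i, 1 ≤ i → (b i).order < 0)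
    (hne : a 1 - b 1 ≠ 0) (n : ℕ) : n ≤ N →
    a (n + 1) - b (n + 1) ≠ 0 ∧ (a (n+1) - b (n+1)).order + 2 * n ≤ (a 1 - b 1).order := by
  induction n with
  | zero => intro _; simpa using hne
  | succ n ih =>
    intro h
    obtain ⟨h1, h2⟩ := ih (by omega)
    obtain ⟨_, h3, h4⟩ := aux_step _ _ _ _ _ (ha (n+1) (by omega) h) (hb (n+1) (by omega) h)
      (oa _ (by omega)) (ob _ (by omega)) h1
    refine ⟨h3, ?_⟩
    push_cast
    linarith

theorem aux_unique {F : Type*} [Field F] (a b c : ℕ → LaurentSeries F)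
    (ha : ∀ i, 1 ≤ i → a i = c i + (a (i+1))⁻¹)
    (hb : ∀ i, 1 ≤ i → b i = c i + (b (i+1))⁻¹)
    (oa : ∀ i, 1 ≤ i → (a i).order < 0) (ob : ∀ i, 1 ≤ i → (b i).order < 0) : a 1 = b 1 := by
  by_contra hne
  have hne := sub_ne_zero.2 hne
  set N := (a 1 - b 1).order.toNat
  obtain ⟨h1, h2⟩ := aux_iter a b c N (fun i h _ => ha i h) (fun i h _ => hb i h) oa ob hne N le_rfl
  obtain ⟨h3, _, _⟩ := aux_step _ _ _ _ _ (ha (N+1) (by omega)) (hb (N+1) (by omega))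
      (oa _ (by omega)) (ob _ (by omega)) h1
  have := Int.self_le_toNat (a 1 - b 1).order
  omega

theorem aux_rho {F : Type*} [Field F] (t : LaurentSeries F) (ρs : ℕ → LaurentSeries F)
    (hρord : ∀ n, 1 ≤ n → (ρs n).order < 0)
    (hρcf : ∀ n, 1 ≤ n → ρs n = 2 * (-1) ^ n * t + (ρs (n + 1))⁻¹) :
    ∀ n, ρs (n + 1) = (-1) ^ n * ρs 1 := by
  have key : ∀ n, ρs (n + 2) = - ρs (n + 1) := by
    intro n
    have := aux_unique (fun i => ρs (n + 1 + i)) (fun i => - ρs (n + i))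
      (fun i => 2 * (-1) ^ (n + 1 + i) * t) ?_ ?_ ?_ ?_
    · exact this
    · intro i hi; exact hρcf _ (by omega)
    · intro i hi
      show - ρs (n + i) = 2 * (-1) ^ (n + 1 + i) * t + (- ρs (n + i + 1))⁻¹
      rw [hρcf (n + i) (by omega), inv_neg]; ring
    · intro i hi; exact hρord _ (by omega)
    · intro i hi
      show (- ρs (n + i)).order < 0
      rw [HahnSeries.order_neg]; exact hρord _ (by omega)
  intro n
  induction n with
  | zero => simp
  | succ n ih => rw [key, ih]; ring

theorem aux_prod {S : Type*} [CommRing S] (r : S) (k : ℕ) :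
    ∏ i ∈ Finset.range (2 * k + 1), ((-1) ^ i * r) = (-1) ^ k * r ^ (2 * k + 1) := by
  induction k with
  | zero => simp
  | succ k ih =>
    rw [show 2 * (k + 1) + 1 = 2 * k + 1 + 1 + 1 by ring, Finset.prod_range_succ,
      Finset.prod_range_succ, ih]
    have : ((-1 : S) ^ k) * (-1) ^ k = 1 := by rw [← mul_pow]; simp
    linear_combination (-(-1) ^ k * r ^ (2 * k + 3) * ((-1 : S) ^ k * (-1) ^ k + 1)) * this

/-- Product formula for the left part. -/
theorem aux_A {S : Type*} [CommRing S] (r s t : S) (hrs : r * s = 1) (hsum : r + s = -(2 * t))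
    (a : ℕ → S) (a0 : a 0 = 1) (N : ℕ) (a1 : a 1 = 2 * (-1) ^ 1 * t)
    (ha : ∀ i, i + 2 ≤ N → a (i + 2) = 2 * (-1) ^ (i + 2) * t * a (i + 1) + a i) (i : ℕ) :
    i + 1 ≤ N →
    a (i + 1) * ((-1) ^ (i + 1) * r) + a i = ∏ n ∈ Finset.range (i + 2), ((-1) ^ n * r) := by
  induction i with
  | zero =>
    intro _
    rw [Finset.prod_range_succ, Finset.prod_range_succ, a0, a1]
    simp
    linear_combination r * hsum - hrs
  | succ i ih =>
    intro h
    rw [Finset.prod_range_succ, ← ih (by omega), ha i h]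
    have : ((-1 : S) ^ i) * (-1) ^ i = 1 := by rw [← mul_pow]; simp
    have e1 : (-1 : S) ^ (i + 1 + 1) = (-1) ^ i := by ring
    have e3 : (-1 : S) ^ (i + 1) = - (-1) ^ i := by ring
    rw [e1, e3]
    linear_combination (a (i+1) * 2 * t * r + a (i+1) * r ^ 2) * this - a (i+1) * hrs
      + a (i + 1) * r * hsum

/-- Product formula for the right part. `b i = K_{j+1,j+i}`, `d i = K_{j+2,j+1+i}`. -/
theorem aux_B {S : Type*} [CommRing S] (r s t : S) (hrs : r * s = 1) (hsum : r + s = -(2 * t))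
    (j N : ℕ) (b d : ℕ → S) (b0 : b 0 = 1) (d0 : d 0 = 1)
    (b1 : b 1 = 2 * (-1) ^ (j + 1) * t)
    (d1 : 2 ≤ N → d 1 = 2 * (-1) ^ (j + 2) * t)
    (hb : ∀ i, i + 2 ≤ N → b (i + 2) = 2 * (-1) ^ (j + i + 2) * t * b (i + 1) + b i)
    (hd : ∀ i, i + 3 ≤ N → d (i + 2) = 2 * (-1) ^ (j + i + 3) * t * d (i + 1) + d i) (i : ℕ) :
    i + 1 ≤ N →
    (d i * ((-1) ^ j * r) - b (i + 1)) *
      ∏ n ∈ Finset.range (i + 1), ((-1) ^ (j + 1 + n) * r) = (-1) ^ i := by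
  have sq : ∀ n : ℕ, ((-1 : S) ^ n) * (-1) ^ n = 1 := fun n => by rw [← mul_pow]; simp
  have step : ∀ i, i + 2 ≤ N → d (i + 1) * ((-1) ^ j * r) - b (i + 2)
      = (d i * ((-1) ^ j * r) - b (i + 1)) * (-((-1) ^ (j + i) * s)) := by
    intro i
    induction i with
    | zero =>
      intro h
      have := hb 0 (by omega)
      simp only [Nat.zero_add, Nat.add_zero] at this ⊢
      rw [this, d0, d1 (by omega), b1, b0]
      have e2 : (-1 : S) ^ (j + 2) = (-1) ^ j := by ring
      have e3 : (-1 : S) ^ (j + 1) = - (-1) ^ j := by ring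
      rw [e2, e3]
      linear_combination (2 * t * r + 4 * t ^ 2 + r * s + 2 * t * s) * sq j
        + 2 * t * hsum + hrs
    | succ i ih =>
      intro h
      have h1 := ih (by omega)
      have h2 : d i * ((-1) ^ j * r) - b (i + 1)
        = (d (i + 1) * ((-1) ^ j * r) - b (i + 2)) * (-((-1) ^ (j + i) * r)) := by
        rw [h1]
        linear_combination (-(d i * ((-1) ^ j * r) - b (i + 1))) * (r * s * sq (j + i) + hrs)
      have e1 : (-1 : S) ^ (j + i + 3) = - (-1) ^ (j + i) := by ring
      have e2 : (-1 : S) ^ (j + (i + 1) + 2) = - (-1) ^ (j + i) := by ring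
      have e3 : (-1 : S) ^ (j + (i + 1)) = - (-1) ^ (j + i) := by ring
      have hb' := hb (i + 1) (by omega)
      have hd' := hd i (by omega)
      rw [e1] at hd'
      rw [e2] at hb'
      rw [e3]
      rw [show i + 1 + 2 = i + 3 by ring, show i + 1 + 1 = i + 2 by ring] at *
      rw [hb', hd']
      linear_combination h2 - (-1) ^ (j + i) * (d (i + 1) * ((-1) ^ j * r) - b (i + 2)) * hsum
  induction i with
  | zero =>
    intro _
    simp only [Nat.zero_add, Finset.prod_range_one, Nat.add_zero, pow_zero]
    rw [d0, b1]
    have e3 : (-1 : S) ^ (j + 1) = - (-1) ^ j := by ring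
    rw [e3]
    linear_combination (-(r ^ 2 + 2 * t * r)) * sq j - r * hsum + hrs
  | succ i ih =>
    intro h
    have h1 := ih (by omega)
    rw [Finset.prod_range_succ, step i h]
    have e3 : (-1 : S) ^ (j + 1 + (i + 1)) = (-1) ^ (j + i) := by ring
    rw [e3]
    linear_combination (-((-1) ^ (j + i) * s * ((-1) ^ (j + i) * r))) * h1
      - (-1) ^ i * (r * s * sq (j + i) + hrs)

theorem aux_dvd (p k : ℕ) [Fact (Nat.Prime p)] (hpk : p = 2 * k + 1) (hodd : Odd p)
    (w : ℕ → ZMod p) (hw : ∀ i, 1 ≤ i → i ≤ 2 * k → w i = 2 * (-1) ^ i)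
    (j : ℕ) (hj1 : 1 ≤ j) (hj2 : j ≤ 2 * k - 1) (εA : ZMod p) (hε : εA = (-1) ^ k)
    (K : ℕ → ℕ → Polynomial (ZMod p))
    (hK : ∀ n m, K n m = cont ((List.range (m + 1 - n)).map fun i => C (w (n + i)) * X))
    (H : Polynomial (Polynomial (ZMod p)))
    (hH : H = C (K (j + 2) (2 * k)) * X ^ (p + 1) - C (K (j + 1) (2 * k)) * X ^ p
        + C (C εA) * (C (K 1 j) * X + C (K 1 (j - 1))))
    (P : Polynomial (Polynomial (ZMod p)))
    (hP : P = X ^ 2 + C (C (2 * (-1 : ZMod p) ^ j) * X) * X + 1) : P ∣ H := by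
  rw [← AdjoinRoot.mk_eq_zero]
  set x := AdjoinRoot.root P with hx
  set φ : (ZMod p)[X] →+* AdjoinRoot P := AdjoinRoot.of P with hφ
  set t := φ X with ht
  have hsq : ∀ n : ℕ, ((-1 : AdjoinRoot P) ^ n) * (-1) ^ n = 1 := fun n => by
    rw [← mul_pow]; simp
  have hφ2 : φ (C 2) = 2 := map_ofNat (φ.comp C) 2
  have hx2 : x ^ 2 + 2 * (-1) ^ j * t * x + 1 = 0 := by
    have h : AdjoinRoot.mk P P = 0 := AdjoinRoot.mk_self
    conv at h => lhs; arg 2; rw [hP]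
    simp only [map_add, map_mul, map_pow, AdjoinRoot.mk_C, AdjoinRoot.mk_X, map_one, map_neg,
      ← hφ, ← hx, ← ht, hφ2] at h
    exact h
  set c : ℕ → ℕ → AdjoinRoot P := fun n i =>
    φ (cont ((List.range i).map fun i => C (w (n + i)) * X)) with hcdef
  have c0 : ∀ n, c n 0 = 1 := by intro n; simp [hcdef, cont]
  have c1 : ∀ n, 1 ≤ n → n ≤ 2 * k → c n 1 = 2 * (-1) ^ n * t := by
    intro n h1 h2
    simp [hcdef, cont, hw n h1 h2, hφ2, ht]
  have c2 : ∀ n i, 1 ≤ n → n + i + 1 ≤ 2 * k →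
      c n (i + 2) = 2 * (-1) ^ (n + i + 1) * t * c n (i + 1) + c n i := by
    intro n i h1 h2
    simp only [hcdef, aux_cont, map_add, map_mul]
    rw [← add_assoc, hw _ (by omega) h2]
    simp [hφ2, ht]
  set r := (-1) ^ j * x with hr
  set s := -(r + 2 * t) with hs
  have hsum : r + s = -(2 * t) := by rw [hs]; ring
  have hrs : r * s = 1 := by
    rw [hs, hr]
    linear_combination -hx2 - x ^ 2 * hsq j
  have hxr : x = (-1) ^ j * r := by rw [hr, ← mul_assoc, hsq, one_mul]
  obtain ⟨i, rfl⟩ : ∃ i, j = i + 1 := ⟨j - 1, by omega⟩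
  have hA := aux_A r s t hrs hsum (c 1) (c0 1) (2 * k) (c1 1 le_rfl (by omega))
    (fun n hn => by
      rw [c2 1 n le_rfl (by omega), show 1 + n + 1 = n + 2 by ring]) i (by omega)
  obtain ⟨m, hm⟩ : ∃ m, 2 * k = i + 1 + m + 1 := ⟨2 * k - (i + 2), by omega⟩
  have hB := aux_B r s t hrs hsum (i + 1) (m + 1) (c (i + 2)) (c (i + 3)) (c0 _) (c0 _)
    (c1 _ (by omega) (by omega)) (fun h => c1 _ (by omega) (by omega))
    (fun n hn => by
      rw [c2 _ n (by omega) (by omega), show i + 2 + n + 1 = i + 1 + n + 2 by ring])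
    (fun n hn => by
      rw [c2 _ n (by omega) (by omega), show i + 3 + n + 1 = i + 1 + n + 3 by ring]) m le_rfl
  set Q := ∏ n ∈ Finset.range (m + 1), ((-1) ^ (i + 1 + 1 + n) * r) with hQ
  have hMQ : (∏ n ∈ Finset.range (i + 2), ((-1) ^ n * r)) * Q = (-1) ^ k * r ^ p := by
    have h := aux_prod r k
    rw [show 2 * k + 1 = (i + 2) + (m + 1) by omega, Finset.prod_range_add] at h
    rw [hQ, h]
    exact congrArg (fun n => (-1) ^ k * r ^ n) (show (i + 2) + (m + 1) = p by omega)
  rw [← hA] at hMQ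
  have k1 : φ (K (i + 1 + 2) (2 * k)) = c (i + 3) m := by
    rw [hK, show 2 * k + 1 - (i + 1 + 2) = m by omega]
  have k2 : φ (K (i + 1 + 1) (2 * k)) = c (i + 2) (m + 1) := by
    rw [hK, show 2 * k + 1 - (i + 1 + 1) = m + 1 by omega]
  have k3 : φ (K 1 (i + 1)) = c 1 (i + 1) := by
    rw [hK, show i + 1 + 1 - 1 = i + 1 by omega]
  have k4 : φ (K 1 (i + 1 - 1)) = c 1 i := by
    rw [hK, show i + 1 - 1 + 1 - 1 = i by omega]
  have hHx : AdjoinRoot.mk P H = c (i + 3) m * x ^ (p + 1) - c (i + 2) (m + 1) * x ^ p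
      + (-1) ^ k * (c 1 (i + 1) * x + c 1 i) := by
    rw [hH, ← k1, ← k2, ← k3, ← k4, hε]
    simp [AdjoinRoot.mk_C, AdjoinRoot.mk_X, hφ, hx]
  have hQu : IsUnit Q := by
    rw [hQ]
    refine IsUnit.prod_iff.2 ?_
    intro n _
    exact ((isUnit_one.neg).pow _).mul (IsUnit.of_mul_eq_one s hrs)
  rw [hHx, ← hQu.mul_left_eq_zero]
  have hxp : x ^ p = (-1) ^ (i + 1) * r ^ p := by
    rw [hxr, mul_pow, ← pow_mul, mul_comm (i + 1) p, pow_mul, hodd.neg_one_pow]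
  have hmi : (-1 : AdjoinRoot P) ^ m = (-1) ^ i := by
    have h1 : (-1 : AdjoinRoot P) ^ (m + i) = 1 := by
      rw [show m + i = 2 * (k - 1) by omega, pow_mul]; simp
    rw [pow_add] at h1
    linear_combination (-1) ^ i * h1 - (-1) ^ m * hsq i
  rw [hmi, ← hxr] at hB
  rw [← hxr] at hMQ
  have : (c (i + 3) m * x ^ (p + 1) - c (i + 2) (m + 1) * x ^ p
      + (-1) ^ k * (c 1 (i + 1) * x + c 1 i)) * Q
      = x ^ p * ((c (i + 3) m * x - c (i + 2) (m + 1)) * Q)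
        + (-1) ^ k * ((c 1 (i + 1) * x + c 1 i) * Q) := by ring
  rw [this, hB, hMQ, hxp]
  linear_combination r ^ p * hsq k - r ^ p * hsq i

theorem stmt_19 (p k : ℕ) [Fact (Nat.Prime p)] (hodd : Odd p)
    (hk1 : 1 ≤ k) (hpk : p = 2 * k + 1)  -- `k = (p-1)/2`
    (ω : ZMod p)
    (hω : ω = (-1) ^ (k - 1) * ∏ i ∈ Finset.Icc 1 k, (1 - (2 * (i : ZMod p))⁻¹))
    (w : ℕ → ZMod p)
    (hwne : ∀ i, 1 ≤ i → i ≤ 2 * k → w i ≠ 0)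
    (hw1 : w 1 = (2 * (k : ZMod p) - 1) * (2 * (k : ZMod p) * ω)⁻¹)
    (hwrec : ∀ i, 1 ≤ i → i ≤ 2 * k - 1 →
      w (i + 1) * w i =
        (2 * (k : ZMod p) - 2 * (i : ZMod p) - 1) * (2 * (k : ZMod p) - 2 * (i : ZMod p) + 1)
          * ((i : ZMod p) * (2 * (k : ZMod p) - (i : ZMod p)))⁻¹)
    (j : ℕ) (hj1 : 1 ≤ j) (hj2 : j ≤ 2 * k - 1)
    -- `ε_A = (-1)^{k+j+1}·[w_{j+1}, …, w_{2k}, ω_k]`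
    (εA : ZMod p)
    (hεA : εA = (-1) ^ (k + j + 1)
      * cfrac (((List.range (2 * k - j)).map fun i => w (j + 1 + i)) ++ [ω]))
    -- the continuants `K_{n,m} = ⟨w_n T, …, w_m T⟩`
    (K : ℕ → ℕ → Polynomial (ZMod p))
    (hK : ∀ n m, K n m = cont ((List.range (m + 1 - n)).map fun i => C (w (n + i)) * X))
    -- the polynomial `H(V)` for `V = [p, k, j, ε_A]`
    (H : Polynomial (Polynomial (ZMod p)))
    (hH : H = C (K (j + 2) (2 * k)) * X ^ (p + 1) - C (K (j + 1) (2 * k)) * X ^ p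
        + C (C εA) * (C (K 1 j) * X + C (K 1 (j - 1))))
    -- the quadratic polynomial `P(X) = X² + 2(-1)^j·T·X + 1`
    (P : Polynomial (Polynomial (ZMod p)))
    (hP : P = X ^ 2 + C (C (2 * (-1 : ZMod p) ^ j) * X) * X + 1)
    -- `α = [w_{j+1}T, …, w_{2k}T, α_{2k-j+1}]`, an infinite continued fraction with
    -- complete quotients `αs` (`α = αs 1`), and `α^p = ε_A(-1)^{k+j}(P_k α_{2k-j+1} - R_k)`
    (α : LaurentSeries (ZMod p)) (αs : ℕ → LaurentSeries (ZMod p)) (hα1 : αs 1 = α)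
    (hord : ∀ n, 1 ≤ n → (αs n).order < 0)
    (hinit : ∀ i, 1 ≤ i → i ≤ 2 * k - j →
      αs i = aeval (Tinv (ZMod p)) (C (w (j + i)) * X) + (αs (i + 1))⁻¹)
    (htail : ∀ n, 2 * k - j < n → ∃ b : Polynomial (ZMod p),
      0 < b.degree ∧ αs n = aeval (Tinv (ZMod p)) b + (αs (n + 1))⁻¹)
    (heq : α ^ p
      = algebraMap (ZMod p) (LaurentSeries (ZMod p)) (εA * (-1) ^ (k + j))
        * (aeval (Tinv (ZMod p)) (Pk p k) * αs (2 * k - j + 1)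
            - aeval (Tinv (ZMod p)) (Rk p k)))
    -- `ρ = [-2T, 2T, -2T, 2T, …]`, with complete quotients `ρs n` (`ρ = ρs 1`)
    (ρ : LaurentSeries (ZMod p)) (ρs : ℕ → LaurentSeries (ZMod p)) (hρ1 : ρs 1 = ρ)
    (hρord : ∀ n, 1 ≤ n → (ρs n).order < 0)
    (hρcf : ∀ n, 1 ≤ n →
      ρs n = aeval (Tinv (ZMod p)) (C (2 * (-1 : ZMod p) ^ n) * X) + (ρs (n + 1))⁻¹) :
    εA = (-1) ^ k ∧
    P ∣ H ∧
    α = algebraMap (ZMod p) (LaurentSeries (ZMod p)) ((-1) ^ j) * ρ ∧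
    Polynomial.eval₂
      ((aeval (Tinv (ZMod p)) : Polynomial (ZMod p) →ₐ[ZMod p] LaurentSeries (ZMod p)) :
        Polynomial (ZMod p) →+* LaurentSeries (ZMod p))
      α P = 0 := by
  have hω1 : ω = -1 := by
    rw [hω, aux_omega p k hpk, ← pow_add, show k - 1 + k = 2 * (k - 1) + 1 by omega, pow_succ,
      pow_mul]
    simp
  have hw := aux_w p k hk1 hpk ω hω1 w hw1 hwrec
  have hε : εA = (-1) ^ k := by
    have h := aux_cfrac w (2 * k - j) j (fun i h1 h2 => hw i (by omega) (by omega))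
    rw [show j + (2 * k - j) + 1 = 2 * k + 1 by omega, pow_succ (-1 : ZMod p) (2 * k), pow_mul,
      neg_one_sq, one_pow, one_mul, ← hω1] at h
    rw [hεA, h, hω1, ← pow_add, show k + j + 1 + (j + 1) = k + 2 * (j + 1) by ring, pow_add, pow_mul]
    simp
  set t := Tinv (ZMod p) with ht
  have hal2 : algebraMap (ZMod p) (LaurentSeries (ZMod p)) 2 = 2 := map_ofNat _ 2
  have hsq : ((-1 : LaurentSeries (ZMod p)) ^ j) * (-1) ^ j = 1 := by rw [← mul_pow]; simp
  have hρcf' : ∀ n, 1 ≤ n → ρs n = 2 * (-1) ^ n * t + (ρs (n + 1))⁻¹ := by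
    intro n hn
    rw [hρcf n hn]
    simp [hal2]
  have hρall := aux_rho t ρs hρord hρcf'
  rw [hρ1] at hρall
  have hρ0 : ρ ≠ 0 := by
    rintro rfl
    have := hρord 1 le_rfl
    rw [hρ1] at this
    simp at this
  have hquad : ρ ^ 2 + 2 * t * ρ + 1 = 0 := by
    have h1 := hρcf' 1 le_rfl
    have h2 := hρall 1
    rw [hρ1, h2, pow_one, neg_one_mul, inv_neg] at h1
    have h3 := mul_inv_cancel₀ hρ0
    linear_combination ρ * h1 - h3
  have hρp : ρ ^ p = (t ^ 2 - 1) ^ k * ρ - (t ^ p - t * (t ^ 2 - 1) ^ k) := by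
    have : CharP (LaurentSeries (ZMod p)) p :=
      charP_of_injective_algebraMap (algebraMap (ZMod p) (LaurentSeries (ZMod p))).injective p
    have h1 : (ρ + t) ^ 2 = t ^ 2 - 1 := by linear_combination hquad
    have h2 : (ρ + t) ^ p = ρ ^ p + t ^ p := add_pow_char _ _ _
    have h3 : (ρ + t) ^ p = (t ^ 2 - 1) ^ k * (ρ + t) := by
      rw [← h1, ← pow_mul, ← pow_succ]
      exact congrArg _ hpk
    linear_combination h3 - h2
  have hPk : aeval t (Pk p k) = (t ^ 2 - 1) ^ k := by simp [Pk]
  have hRk : aeval t (Rk p k) = t ^ p - t * (t ^ 2 - 1) ^ k := by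
    rw [aux_R p k hk1 hpk, map_sub, map_mul, hPk]; simp
  have hc : algebraMap (ZMod p) (LaurentSeries (ZMod p)) (εA * (-1) ^ (k + j)) = (-1) ^ j := by
    rw [hε, ← pow_add, show k + (k + j) = 2 * k + j by ring, pow_add, pow_mul]
    simp
  have hmain : α = (-1) ^ j * ρ := by
    by_contra hne
    have hne' : αs 1 - (-1) ^ j * ρs 1 ≠ 0 := by
      rw [hα1, hρ1]; exact sub_ne_zero.2 hne
    have hordneg : ∀ x : LaurentSeries (ZMod p), ((-1) ^ j * x).order = x.order := by
      intro x
      rcases neg_one_pow_eq_or (LaurentSeries (ZMod p)) j with h | h <;> rw [h] <;> simp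
    have hb : ∀ i, 1 ≤ i → i ≤ 2 * k - j → (-1) ^ j * ρs i
        = 2 * (-1) ^ (j + i) * t + ((-1) ^ j * ρs (i + 1))⁻¹ := by
      intro i hi _
      rw [hρcf' i hi, mul_inv, ← inv_pow, inv_neg_one, pow_add]; ring
    have ha : ∀ i, 1 ≤ i → i ≤ 2 * k - j → αs i
        = 2 * (-1) ^ (j + i) * t + (αs (i + 1))⁻¹ := by
      intro i hi h2
      rw [hinit i hi h2, hw (j + i) (by omega) (by omega)]
      simp [hal2]
    have hob : ∀ i, 1 ≤ i → ((-1) ^ j * ρs i).order < 0 := by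
      intro i hi; rw [hordneg]; exact hρord i hi
    obtain ⟨h1, h2⟩ := aux_iter αs (fun i => (-1) ^ j * ρs i) (fun i => 2 * (-1) ^ (j + i) * t)
      (2 * k - j) ha hb hord hob hne' (2 * k - j) le_rfl
    obtain ⟨h3, _, _⟩ := aux_step _ _ _ _ _ (ha 1 le_rfl (by omega)) (hb 1 le_rfl (by omega))
      (hord _ (by omega)) (hob _ (by omega)) hne'
    have hρlast : ρs (2 * k - j + 1) = (-1) ^ j * ρ := by
      rw [hρall]
      congr 1
      rcases Nat.even_or_odd j with h | h
      · rw [h.neg_one_pow, Even.neg_one_pow]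
        rw [Nat.even_sub (by omega)]; simp [h]
      · rw [h.neg_one_pow, Odd.neg_one_pow]
        rcases h with ⟨q, hq⟩; exact ⟨k - q - 1, by omega⟩
    have hlast : (-1) ^ j * ρs (2 * k - j + 1) = ρ := by
      rw [hρlast, ← mul_assoc, hsq, one_mul]
    simp only [hlast] at h1 h2
    rw [hα1, hρ1] at h2 h3 hne'
    have hjp : ((-1 : LaurentSeries (ZMod p)) ^ j) ^ p = (-1) ^ j := by
      rw [← pow_mul, mul_comm, pow_mul, hodd.neg_one_pow]
    have hdiff : (α - (-1) ^ j * ρ) ^ p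
        = (-1) ^ j * ((t ^ 2 - 1) ^ k * (αs (2 * k - j + 1) - ρ)) := by
      have : CharP (LaurentSeries (ZMod p)) p :=
        charP_of_injective_algebraMap (algebraMap (ZMod p) (LaurentSeries (ZMod p))).injective p
      rw [sub_pow_char, mul_pow, hjp, heq, hc, hPk, hRk, hρp]
      ring
    have htc : (t ^ 2 - 1).coeff 0 ≠ 0 := by
      have h1 : t ^ 2 = HahnSeries.single (-2 : ℤ) 1 := by
        rw [ht, Tinv, HahnSeries.single_pow]; simp
      rw [h1, HahnSeries.coeff_sub, HahnSeries.coeff_single_of_ne (by norm_num)]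
      simp
    have ht0 : t ^ 2 - 1 ≠ 0 := by
      intro h; rw [h] at htc; simp at htc
    have hto : (t ^ 2 - 1).order ≤ 0 := HahnSeries.order_le_of_coeff_ne_zero htc
    have hkey := congrArg HahnSeries.order hdiff
    rw [hordneg, HahnSeries.order_mul (pow_ne_zero _ ht0) h1, HahnSeries.order_pow,
      HahnSeries.order_pow] at hkey
    simp only [nsmul_eq_mul] at hkey
    have hp1 : (1 : ℤ) ≤ p := by exact_mod_cast (by omega : 1 ≤ p)
    have hk0 : (k : ℤ) * (t ^ 2 - 1).order ≤ 0 :=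
      mul_nonpos_of_nonneg_of_nonpos (by positivity) hto
    have hp2 : (α - (-1) ^ j * ρ).order ≤ p * (α - (-1) ^ j * ρ).order := by nlinarith
    omega
  refine ⟨hε, ?_, ?_, ?_⟩
  · exact aux_dvd p k hpk hodd w hw j hj1 hj2 εA hε K hK H hH P hP
  · rw [hmain]; simp
  · rw [hP, hmain]
    simp only [eval₂_add, eval₂_mul, eval₂_pow, eval₂_X, eval₂_C, eval₂_one]
    simp [hal2]
    linear_combination hquad + (ρ ^ 2 + 2 * t * ρ) * hsq
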